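/- Let X and E be finite-dimensional real normed spaces and f : S_X → S_E a bijective isometry, and let y ∈ S_X. If y ∈ Σ(X), then the set {γ((x − y)/‖x − y‖) : x ∈ W_y} is 1-norming for X, i.e. sup{|⟨γ((x − y)/‖x − y‖), z⟩| : x ∈ W_y} = ‖z‖ for every z ∈ X. If f(y) ∈ Σ(E), then the set {γ((f(x) − f(y))/‖f(x) − f(y)‖) : x ∈ W_y} is 1-norming for E. -/

import Mathlib

open Filter Topology Metric Set MeasureTheory

noncomputable section

/-- The normalized direction `v / ‖v‖` of a vector (equal to `0` when `v = 0`). -/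
def unitDir {X : Type*} [NormedAddCommGroup X] [NormedSpace ℝ X] (v : X) : X := ‖v‖⁻¹ • v

/-- The set `ℷ(x)` of support functionals at a point `x` of the unit sphere:
functionals of norm one attaining the value `1` at `x`. -/
def suppFn (X : Type*) [NormedAddCommGroup X] [NormedSpace ℝ X] (x : X) :
    Set (X →L[ℝ] ℝ) := {g | ‖g‖ = 1 ∧ g x = 1}

/-- A point of the unit sphere is smooth if it has exactly one support functional. -/
def IsSmoothPt {X : Type*} [NormedAddCommGroup X] [NormedSpace ℝ X] (x : X) : Prop :=
  ∃ g : X →L[ℝ] ℝ, suppFn X x = {g}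

/-- `D_y = {x ∈ S_X : ‖x + y‖ < 2}`. -/
def Dset {X : Type*} [NormedAddCommGroup X] [NormedSpace ℝ X] (y : X) : Set X :=
  {x | x ∈ sphere (0 : X) 1 ∧ ‖x + y‖ < 2}

/-- `W_y`: points `x ∈ D_y` with `(x-y)/‖x-y‖` smooth in `X` and
`(f x - f y)/‖f x - f y‖` smooth in `E`. -/
def Wset {X E : Type*} [NormedAddCommGroup X] [NormedSpace ℝ X]
    [NormedAddCommGroup E] [NormedSpace ℝ E] (f : X → E) (y : X) : Set X :=
  {x | x ∈ Dset y ∧ IsSmoothPt (unitDir (x - y)) ∧ IsSmoothPt (unitDir (f x - f y))}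

/-- `Λ_y`: the set of limit points of `(y - z)/‖y - z‖` as `z → y`, `z ∈ S_X`, `z ≠ y`. -/
def tangentDirs {X : Type*} [NormedAddCommGroup X] [NormedSpace ℝ X] (y : X) : Set X :=
  {u | ∃ z : ℕ → X, (∀ n, z n ∈ sphere (0 : X) 1 ∧ z n ≠ y) ∧
    Tendsto z atTop (𝓝 y) ∧ Tendsto (fun n => unitDir (y - z n)) atTop (𝓝 u)}

/-- A linear map `T` represents the tangent action of `f` at `y`: whenever `y_n → y` on the
sphere with `(y - y_n)/‖y - y_n‖ → u`, one has `(f y - f y_n)/‖f y - f y_n‖ → T u`. -/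
def RepTangent {X E : Type*} [NormedAddCommGroup X] [NormedSpace ℝ X]
    [NormedAddCommGroup E] [NormedSpace ℝ E] (f : X → E) (y : X) (T : X →ₗ[ℝ] E) : Prop :=
  ∀ (z : ℕ → X) (u : X), (∀ n, z n ∈ sphere (0 : X) 1 ∧ z n ≠ y) →
    Tendsto z atTop (𝓝 y) → Tendsto (fun n => unitDir (y - z n)) atTop (𝓝 u) →
    Tendsto (fun n => unitDir (f y - f (z n))) atTop (𝓝 (T u))

/-- The positively homogeneous extension `F` of `f`: `F 0 = 0`, `F x = ‖x‖ • f (x/‖x‖)`. -/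
def homExt {X E : Type*} [NormedAddCommGroup X] [NormedSpace ℝ X]
    [NormedAddCommGroup E] [NormedSpace ℝ E] (f : X → E) (x : X) : E :=
  ‖x‖ • f (unitDir x)

/-- `F` is Gateaux differentiable at `y`: all one-sided directional derivatives exist and
depend linearly (and continuously) on the direction. -/
def GateauxAt {X E : Type*} [NormedAddCommGroup X] [NormedSpace ℝ X]
    [NormedAddCommGroup E] [NormedSpace ℝ E] (F : X → E) (y : X) : Prop :=
  ∃ L : X →L[ℝ] E, ∀ z : X,
    Tendsto (fun a : ℝ => a⁻¹ • (F (y + a • z) - F y)) (𝓝[>] 0) (𝓝 (L z))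

section SmoothPoints

variable {V : Type*} [NormedAddCommGroup V] [NormedSpace ℝ V]

lemma suppFn_abs_le {x : V} {g : V →L[ℝ] ℝ} (hg : g ∈ suppFn V x) (z : V) : |g z| ≤ ‖z‖ := by
  have h := g.le_opNorm z
  rwa [hg.1, one_mul, Real.norm_eq_abs] at h

lemma suppFn_apply_eq_norm {v : V} {g : V →L[ℝ] ℝ} (hg : g ∈ suppFn V (unitDir v)) :
    g v = ‖v‖ := by
  have h : ‖v‖⁻¹ * g v = 1 := by simpa [unitDir] using hg.2
  have hv : ‖v‖ ≠ 0 := by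
    intro h0
    simp [h0] at h
  field_simp at h
  exact h

/-- A unit vector on a common face with a smooth point `y` lies on the face exposed by the
support functional of `y`. -/
lemma suppFn_apply_eq_one_of_norm_add {y q : V} {γ : V →L[ℝ] ℝ} (hγ : suppFn V y = {γ})
    (hy : ‖y‖ = 1) (hq : ‖q‖ = 1) (h : ‖y + q‖ = 2) : γ q = 1 := by
  obtain ⟨g, hg, hgv⟩ := exists_dual_vector ℝ (y + q) (by rw [h]; norm_num)
  have hgv' : g y + g q = 2 := by
    rw [← map_add, hgv, h]
    norm_num
  have h1 := (le_abs_self _).trans (g.le_opNorm y)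
  have h2 := (le_abs_self _).trans (g.le_opNorm q)
  rw [hg, hy] at h1
  rw [hg, hq] at h2
  have hmem : g ∈ suppFn V y := ⟨hg, by linarith⟩
  rw [hγ, mem_singleton_iff] at hmem
  rw [← hmem]
  linarith

/-- Directions on which the support functional of a smooth point is negative enter the ball. -/
lemma exists_norm_add_smul_lt_one {y v : V} {γ : V →L[ℝ] ℝ} (hγ : suppFn V y = {γ})
    (hy : ‖y‖ = 1) (hv : γ v < 0) : ∃ t : ℝ, 0 < t ∧ ‖y + t • v‖ < 1 := by
  by_contra! hcon
  have hconv : Convex ℝ ((fun t : ℝ => y + t • v) '' Ici 0) := by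
    rintro _ ⟨a, ha, rfl⟩ _ ⟨b, hb, rfl⟩ r s hr hs hrs
    refine ⟨r * a + s * b, add_nonneg (mul_nonneg hr ha) (mul_nonneg hs hb), ?_⟩
    obtain rfl : s = 1 - r := by linarith
    module
  have hdisj : Disjoint (ball (0 : V) 1) ((fun t : ℝ => y + t • v) '' Ici 0) := by
    rw [Set.disjoint_left]
    rintro _ hx ⟨t, ht, rfl⟩
    rw [mem_ball_zero_iff] at hx
    rcases (mem_Ici.1 ht).eq_or_lt with rfl | ht
    · simp [hy] at hx
    · exact absurd hx (not_lt.2 (hcon t ht))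
  obtain ⟨g, u, hgu, hug⟩ :=
    geometric_hahn_banach_open (convex_ball 0 1) isOpen_ball hconv hdisj
  have hu : 0 < u := by simpa using hgu 0 (by simp)
  have hle : ∀ z : V, ‖z‖ = 1 → g z ≤ u := by
    intro z hz
    by_contra! hlt
    have h := hgu ((u / g z) • z) (by
      rw [mem_ball_zero_iff, norm_smul, hz, mul_one, Real.norm_eq_abs,
        abs_of_pos (div_pos hu (hu.trans hlt))]
      exact (div_lt_one (hu.trans hlt)).2 hlt)
    rw [map_smul, smul_eq_mul, div_mul_cancel₀ _ (hu.trans hlt).ne'] at h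
    exact lt_irrefl _ h
  have hnorm : ‖g‖ ≤ u := by
    refine ContinuousLinearMap.opNorm_le_of_unit_norm hu.le fun z hz => ?_
    rw [Real.norm_eq_abs, abs_le]
    have := hle (-z) (by rwa [norm_neg])
    rw [map_neg] at this
    exact ⟨by linarith, hle z hz⟩
  have hy0 : u ≤ g y := by simpa using hug y ⟨0, by simp, by simp⟩
  have hyn := (le_abs_self _).trans (g.le_opNorm y)
  rw [hy, mul_one] at hyn
  have hgn : ‖g‖ = u := le_antisymm hnorm (hy0.trans hyn)
  have hgy : g y = u := le_antisymm (hyn.trans hnorm) hy0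
  have hmem : u⁻¹ • g ∈ suppFn V y := by
    refine ⟨?_, ?_⟩
    · rw [norm_smul, hgn, norm_inv, Real.norm_eq_abs, abs_of_pos hu, inv_mul_cancel₀ hu.ne']
    · simp [hgy, hu.ne']
  rw [hγ, mem_singleton_iff] at hmem
  have h1 := hug (y + (1 : ℝ) • v) ⟨1, by simp, rfl⟩
  rw [one_smul, map_add, hgy] at h1
  have h2 : γ v = u⁻¹ * g v := by simp [← hmem]
  have h3 : 0 ≤ u⁻¹ * g v := mul_nonneg (inv_nonneg.2 hu.le) (by linarith)
  linarith

lemma exists_smul_mem_Dset {y v : V} {γ : V →L[ℝ] ℝ} (hγ : suppFn V y = {γ})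
    (hy : ‖y‖ = 1) (hv : γ v < 0) : ∃ T : ℝ, 0 < T ∧ y + T • v ∈ Dset y := by
  obtain ⟨s, hs, hs1⟩ := exists_norm_add_smul_lt_one hγ hy hv
  have hv0 : 0 < ‖v‖ := norm_pos_iff.2 (by rintro rfl; simp at hv)
  set b : ℝ := s + 2 / ‖v‖ with hb
  have hsb : s ≤ b := by rw [hb]; linarith [div_pos two_pos hv0]
  have hb1 : 1 ≤ ‖y + b • v‖ := by
    have h1 : ‖b • v‖ ≤ ‖y + b • v‖ + ‖y‖ := by
      simpa using norm_sub_le (y + b • v) y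
    rw [norm_smul, Real.norm_eq_abs, abs_of_pos (hs.trans_le hsb), hy, hb, add_mul,
      div_mul_cancel₀ _ hv0.ne'] at h1
    have := mul_pos hs hv0
    rw [hb]
    linarith
  obtain ⟨T, hT, hT1⟩ := intermediate_value_Icc hsb
    (f := fun t : ℝ => ‖y + t • v‖) (by fun_prop) ⟨hs1.le, hb1⟩
  have hT0 : 0 < T := hs.trans_le hT.1
  refine ⟨T, hT0, by simpa using hT1, ?_⟩
  have hl0 : 0 ≤ s / T := by positivity
  have hl1 : s / T ≤ 1 := (div_le_one hT0).2 hT.1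
  have hdec : y + T • v + y = (s / T) • y + (1 - s / T) • (y + T • v) + (y + s • v) := by
    have : s • v = (s / T) • T • v := by rw [smul_smul, div_mul_cancel₀ _ hT0.ne']
    rw [this]
    module
  have h1 : ‖(s / T) • y‖ = s / T := by
    rw [norm_smul, hy, mul_one, Real.norm_eq_abs, abs_of_nonneg hl0]
  have h2 : ‖(1 - s / T) • (y + T • v)‖ = 1 - s / T := by
    rw [norm_smul, show ‖y + T • v‖ = 1 from hT1, mul_one, Real.norm_eq_abs,
      abs_of_nonneg (by linarith)]
  rw [hdec]
  calc _ ≤ ‖(s / T) • y‖ + ‖(1 - s / T) • (y + T • v)‖ + ‖y + s • v‖ := norm_add₃_le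
    _ < 2 := by rw [h1, h2]; linarith

/-- Vectors at which the norm is smooth up to `1 / (n + 1)` in the direction `h`. -/
def almostSmooth (h : V) (n : ℕ) : Set V :=
  {v | ∃ t : ℝ, 0 < t ∧ ‖v + t • h‖ + ‖v - t • h‖ - 2 * ‖v‖ < t / (n + 1)}

lemma isOpen_almostSmooth (h : V) (n : ℕ) : IsOpen (almostSmooth h n) := by
  have : almostSmooth h n = ⋃ t : ℝ, ⋃ _ : 0 < t,
      {v | ‖v + t • h‖ + ‖v - t • h‖ - 2 * ‖v‖ < t / (n + 1)} := by
    ext v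
    simp [almostSmooth]
  rw [this]
  exact isOpen_iUnion fun t => isOpen_iUnion fun _ => isOpen_lt (by fun_prop) (by fun_prop)

lemma smul_mem_almostSmooth {h v : V} {n : ℕ} (hv : v ∈ almostSmooth h n) {c : ℝ} (hc : 0 < c) :
    c • v ∈ almostSmooth h n := by
  obtain ⟨t, ht, hlt⟩ := hv
  refine ⟨c * t, mul_pos hc ht, ?_⟩
  rw [mul_smul, ← smul_add, ← smul_sub, norm_smul, norm_smul, norm_smul, Real.norm_eq_abs,
    abs_of_pos hc, mul_div_assoc]
  have := mul_lt_mul_of_pos_left hlt hc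
  linarith

lemma mem_almostSmooth_of_differentiableAt {v : V} (hv : DifferentiableAt ℝ (fun w : V => ‖w‖) v)
    (h : V) (n : ℕ) : v ∈ almostSmooth h n := by
  obtain ⟨L, hL⟩ := hv
  have h1 := hL.hasLineDerivAt h
  have h2 := hL.hasLineDerivAt (-h)
  have h3 := (HasDerivAt.add h1 h2).tendsto_slope_zero_right
  rw [map_neg, add_neg_cancel] at h3
  have hpos : (0 : ℝ) < 1 / (n + 1) := by positivity
  obtain ⟨t, htlt, ht⟩ := ((h3.eventually_lt_const hpos).and self_mem_nhdsWithin).exists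
  have ht : 0 < t := ht
  refine ⟨t, ht, ?_⟩
  simp only [Pi.add_apply, zero_add, zero_smul, add_zero, smul_neg, smul_eq_mul, sub_zero,
    ← sub_eq_add_neg] at htlt
  rw [inv_mul_lt_iff₀ ht] at htlt
  rw [div_eq_mul_one_div]
  linarith

lemma dense_almostSmooth [FiniteDimensional ℝ V] (h : V) (n : ℕ) : Dense (almostSmooth h n) := by
  borelize V
  let μ : Measure V := Measure.addHaar
  have hae : ∀ᵐ v ∂μ, DifferentiableAt ℝ (fun w : V => ‖w‖) v :=
    (lipschitzWith_one_norm (E := V)).ae_differentiableAt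
  exact (Measure.dense_of_ae hae).mono fun v hv => mem_almostSmooth_of_differentiableAt hv h n

lemma isSmoothPt_unitDir_of_almostSmooth {v : V} (hv : v ≠ 0) {s : ℕ → V} (hs : DenseRange s)
    (h : ∀ m n, v ∈ almostSmooth (s m) n) : IsSmoothPt (unitDir v) := by
  obtain ⟨g, hg, hgv⟩ := exists_dual_vector ℝ v (norm_ne_zero_iff.2 hv)
  have hgv' : g v = ‖v‖ := by simpa using hgv
  have hmem : g ∈ suppFn V (unitDir v) := by
    refine ⟨hg, ?_⟩
    simp [unitDir, hgv', hv]
  have key : ∀ g₁ ∈ suppFn V (unitDir v), ∀ g₂ ∈ suppFn V (unitDir v), ∀ w, g₁ w ≤ g₂ w := by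
    intro g₁ h₁ g₂ h₂ w
    have hclosed : IsClosed {w | g₁ w ≤ g₂ w} := isClosed_le g₁.continuous g₂.continuous
    refine hs.induction_on w hclosed fun m => ?_
    refine le_of_forall_pos_le_add fun ε hε => ?_
    obtain ⟨n, hn⟩ := exists_nat_one_div_lt hε
    obtain ⟨t, ht, hlt⟩ := h m n
    have e₁ := (le_abs_self _).trans (suppFn_abs_le h₁ (v + t • s m))
    have e₂ := (le_abs_self _).trans (suppFn_abs_le h₂ (v - t • s m))
    rw [map_add, map_smul, smul_eq_mul, suppFn_apply_eq_norm h₁] at e₁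
    rw [map_sub, map_smul, smul_eq_mul, suppFn_apply_eq_norm h₂] at e₂
    rw [div_eq_mul_one_div] at hlt
    have e₃ : t * (g₁ (s m) - g₂ (s m)) < t * (1 / (n + 1)) := by linarith
    have := lt_of_mul_lt_mul_left e₃ ht.le
    linarith
  refine ⟨g, eq_singleton_iff_unique_mem.2 ⟨hmem, fun k hk => ?_⟩⟩
  ext w
  exact le_antisymm (key k hk g hmem w) (key g hmem k hk w)

/-- A point `x` of `D_y` can be moved along the sphere so that `x - y` enters a given dense cone. -/
lemma exists_sphere_near_sub_mem {x y : V} (hx : ‖x‖ = 1) (hy : ‖y‖ = 1) (hxy : ‖x + y‖ < 2)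
    {U : Set V} (hU : Dense U) (hcone : ∀ v ∈ U, ∀ c : ℝ, 0 < c → c • v ∈ U)
    {η : ℝ} (hη : 0 < η) : ∃ x', ‖x'‖ = 1 ∧ ‖x' - x‖ < η ∧ x' - y ∈ U := by
  obtain ⟨ε, hε, hε2, hεη⟩ : ∃ ε : ℝ, 0 < ε ∧ ε ≤ 1 / 2 ∧ 8 * ε ≤ η :=
    ⟨min (1 / 2) (η / 8), by positivity, min_le_left _ _,
      by linarith [min_le_right (1 / 2) (η / 8)]⟩
  have hlow : ‖y + (1 - ε) • (x - y)‖ < 1 := by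
    have hdec : y + (1 - ε) • (x - y) = (1 - 2 * ε) • x + ε • (x + y) := by module
    rw [hdec]
    refine (norm_add_le _ _).trans_lt ?_
    rw [norm_smul, norm_smul, hx, Real.norm_eq_abs, Real.norm_eq_abs, abs_of_pos hε,
      abs_of_nonneg (by linarith)]
    nlinarith
  have hhigh : 1 < ‖y + (1 + ε) • (x - y)‖ := by
    have hdec : (1 + 2 * ε) • x = (y + (1 + ε) • (x - y)) + ε • (x + y) := by module
    have h1 := norm_add_le (y + (1 + ε) • (x - y)) (ε • (x + y))
    rw [← hdec, norm_smul, norm_smul, hx, Real.norm_eq_abs, Real.norm_eq_abs, abs_of_pos hε,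
      abs_of_nonneg (by linarith)] at h1
    nlinarith
  have hO : IsOpen ({u : V | ‖y + (1 - ε) • u‖ < 1} ∩ {u | 1 < ‖y + (1 + ε) • u‖} ∩
      {u | ‖u - (x - y)‖ < ε}) :=
    ((isOpen_lt (by fun_prop) (by fun_prop)).inter (isOpen_lt (by fun_prop) (by fun_prop))).inter
      (isOpen_lt (by fun_prop) (by fun_prop))
  obtain ⟨u, ⟨⟨h1, h2⟩, h3⟩, hu⟩ :=
    hU.inter_open_nonempty _ hO ⟨x - y, ⟨hlow, hhigh⟩, by simpa using hε⟩
  simp only [mem_ofPred_eq] at h1 h2 h3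
  obtain ⟨t, ht, ht1⟩ := intermediate_value_Icc (by linarith : 1 - ε ≤ 1 + ε)
    (f := fun t : ℝ => ‖y + t • u‖) (by fun_prop) ⟨h1.le, h2.le⟩
  refine ⟨y + t • u, ht1, ?_, ?_⟩
  · have hdec : y + t • u - x = (t - 1) • u + (u - (x - y)) := by module
    have hun : ‖u‖ ≤ 3 := by
      have e1 : ‖u‖ ≤ ‖u - (x - y)‖ + ‖x - y‖ := by simpa using norm_add_le (u - (x - y)) (x - y)
      have e2 := norm_sub_le x y
      linarith
    have habs : |t - 1| ≤ ε := abs_le.2 ⟨by linarith [ht.1], by linarith [ht.2]⟩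
    have hmul : |t - 1| * ‖u‖ ≤ ε * 3 := mul_le_mul habs hun (norm_nonneg _) hε.le
    rw [hdec]
    refine (norm_add_le _ _).trans_lt ?_
    rw [norm_smul, Real.norm_eq_abs]
    linarith
  · rw [add_sub_cancel_left]
    exact hcone u hu t (by linarith [ht.1])

/-- If `y` is smooth and `W` is dense in `D_y`, then the support functionals at the directions
from `y` to points of `W` are 1-norming. -/
lemma sSup_suppFn_eq_norm {y : V} (hy : ‖y‖ = 1) (hys : IsSmoothPt y) {W : Set V}
    (hW : ∀ x ∈ W, IsSmoothPt (unitDir (x - y)))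
    (hdense : ∀ x ∈ Dset y, ∀ ε > 0, ∃ x' ∈ W, ‖x' - x‖ < ε) (z : V) :
    sSup {t : ℝ | ∃ x ∈ W, ∃ g : V →L[ℝ] ℝ,
      suppFn V (unitDir (x - y)) = {g} ∧ t = |g z|} = ‖z‖ := by
  obtain ⟨γ, hγ⟩ := hys
  have hγy : γ y = 1 := (hγ ▸ mem_singleton γ : γ ∈ suppFn V y).2
  have approx : ∀ w < ‖z‖, ∃ t ∈ {t : ℝ | ∃ x ∈ W, ∃ g : V →L[ℝ] ℝ,
      suppFn V (unitDir (x - y)) = {g} ∧ t = |g z|}, w < t := by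
    intro w hw
    obtain ⟨δ, hδ, hδw⟩ : ∃ δ : ℝ, 0 < δ ∧ w < ‖z‖ - 4 * δ :=
      ⟨(‖z‖ - w) / 8, by linarith, by linarith⟩
    obtain ⟨z₁, hz₁, hγz⟩ : ∃ z₁, (z₁ = z ∨ z₁ = -z) ∧ γ z₁ ≤ 0 := by
      rcases le_total (γ z) 0 with h | h
      · exact ⟨z, .inl rfl, h⟩
      · exact ⟨-z, .inr rfl, by simpa using h⟩
    have hnz : ‖z₁‖ = ‖z‖ := by rcases hz₁ with rfl | rfl <;> simp
    have hneg : γ (z₁ - δ • y) < 0 := by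
      rw [map_sub, map_smul, hγy, smul_eq_mul]
      linarith
    obtain ⟨T, hT, hTD⟩ := exists_smul_mem_Dset hγ hy hneg
    obtain ⟨x, hxW, hx⟩ := hdense _ hTD (T * δ) (mul_pos hT hδ)
    obtain ⟨g, hg⟩ := hW x hxW
    refine ⟨|g z|, ⟨x, hxW, g, hg, rfl⟩, ?_⟩
    have hgm : g ∈ suppFn V (unitDir (x - y)) := hg ▸ mem_singleton g
    have hgz : |g z₁| = |g z| := by rcases hz₁ with rfl | rfl <;> simp
    set r : V := x - (y + T • (z₁ - δ • y)) with hr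
    have hdec : T • z₁ = (x - y) - r + (T * δ) • y := by
      rw [hr]
      module
    have e1 : T * g z₁ = ‖x - y‖ - g r + T * δ * g y := by
      rw [← suppFn_apply_eq_norm hgm, ← smul_eq_mul, ← map_smul, hdec]
      simp
    have e2 : T * ‖z‖ ≤ ‖x - y‖ + ‖r‖ + T * δ := by
      have := norm_add₃_le (a := x - y) (b := -r) (c := (T * δ) • y)
      rwa [← sub_eq_add_neg, ← hdec, norm_smul, norm_smul, norm_neg, hy, mul_one, hnz,
        Real.norm_eq_abs, Real.norm_eq_abs, abs_of_pos hT, abs_of_pos (mul_pos hT hδ)] at this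
    have e3 := (le_abs_self _).trans (suppFn_abs_le hgm r)
    have e4 := (abs_le.1 (suppFn_abs_le hgm y)).1
    have e5 : T * δ * (-1) ≤ T * δ * g y :=
      mul_le_mul_of_nonneg_left (by rwa [hy] at e4) (mul_pos hT hδ).le
    have e6 : T * (‖z‖ - 4 * δ) ≤ T * g z₁ := by linarith
    have e7 := le_of_mul_le_mul_left e6 hT
    rw [← hgz]
    linarith [le_abs_self (g z₁)]
  refine csSup_eq_of_forall_le_of_forall_lt_exists_gt ?_ ?_ approx
  · obtain ⟨t, ht, -⟩ := approx (‖z‖ - 1) (by linarith)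
    exact ⟨t, ht⟩
  · rintro _ ⟨x, -, g, hg, rfl⟩
    exact suppFn_abs_le (hg ▸ mem_singleton g : g ∈ suppFn V (unitDir (x - y))) z

end SmoothPoints

section SphereIsometry

variable {X E : Type*} [NormedAddCommGroup X] [NormedSpace ℝ X]
  [NormedAddCommGroup E] [NormedSpace ℝ E] {f : X → E}

/-- A bijective isometry between unit spheres preserves the relation `‖x + y‖ = 2` at smooth
points `y`. -/
lemma norm_add_eq_two_iff_of_isSmoothPt (hbij : BijOn f (sphere (0 : X) 1) (sphere (0 : E) 1))
    (hiso : ∀ x ∈ sphere (0 : X) 1, ∀ x' ∈ sphere (0 : X) 1, ‖f x - f x'‖ = ‖x - x'‖)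
    {x y : X} (hx : x ∈ sphere (0 : X) 1) (hy : y ∈ sphere (0 : X) 1) (hys : IsSmoothPt y) :
    ‖f x + f y‖ = 2 ↔ ‖x + y‖ = 2 := by
  obtain ⟨γ, hγ⟩ := hys
  have hγm : γ ∈ suppFn X y := hγ ▸ mem_singleton γ
  have hy1 : ‖y‖ = 1 := by simpa using hy
  have face : ∀ q ∈ sphere (0 : X) 1, ‖y + q‖ = 2 → γ q = 1 := fun q hq h =>
    suppFn_apply_eq_one_of_norm_add hγ hy1 (by simpa using hq) h
  have neg_mem : ∀ {q : X}, q ∈ sphere (0 : X) 1 → -q ∈ sphere (0 : X) 1 := fun h => by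
    simpa using h
  have two : ∀ {p q : X}, p ∈ sphere (0 : X) 1 → q ∈ sphere (0 : X) 1 → γ p = 1 → γ q = 1 →
      ‖p + q‖ = 2 := by
    intro p q hp hq h1 h2
    rw [mem_sphere_zero_iff_norm] at hp hq
    have e1 := norm_add_le p q
    have e2 := (le_abs_self _).trans (suppFn_abs_le hγm (p + q))
    rw [map_add] at e2
    linarith
  have antipode : ∀ q ∈ sphere (0 : X) 1, ∃ p ∈ sphere (0 : X) 1, f p = -f q := by
    intro q hq
    exact hbij.surjOn (by simpa using hbij.mapsTo hq)
  have norm_sub_antipode : ∀ {p q : X}, p ∈ sphere (0 : X) 1 → q ∈ sphere (0 : X) 1 →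
      f p = -f q → ‖p - q‖ = 2 := by
    intro p q hp hq h
    have hq1 : ‖f q‖ = 1 := by simpa using hbij.mapsTo hq
    rw [← hiso p hp q hq, h, show -f q - f q = (-2 : ℝ) • f q by module, norm_smul, hq1]
    norm_num
  constructor
  · intro h
    obtain ⟨r, hr, hfr⟩ := antipode (-y) (neg_mem hy)
    obtain ⟨w, hw, hfw⟩ := antipode x hx
    have hγr : γ r = 1 := face r hr (by
      have := norm_sub_antipode hr (neg_mem hy) hfr
      rwa [sub_neg_eq_add, add_comm] at this)
    have hγw : γ (-w) = 1 := face (-w) (neg_mem hw) (by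
      rw [← sub_eq_add_neg, ← hiso y hy w hw, hfw, sub_neg_eq_add, add_comm, h])
    have h2 := two hr (neg_mem hw) hγr hγw
    rw [← sub_eq_add_neg, ← hiso r hr w hw, hfr, hfw, neg_sub_neg, hiso x hx _ (neg_mem hy),
      sub_neg_eq_add] at h2
    exact h2
  · intro h
    obtain ⟨p, hp, hfp⟩ := antipode y hy
    have hγp : γ (-p) = 1 := face (-p) (neg_mem hp) (by
      rw [← sub_eq_add_neg, norm_sub_rev]
      exact norm_sub_antipode hp hy hfp)
    have hγx : γ x = 1 := face x hx (by rwa [add_comm])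
    have h2 := two hx (neg_mem hp) hγx hγp
    rwa [← sub_eq_add_neg, ← hiso x hx p hp, hfp, sub_neg_eq_add] at h2

lemma map_mem_Dset_iff_of_isSmoothPt (hbij : BijOn f (sphere (0 : X) 1) (sphere (0 : E) 1))
    (hiso : ∀ x ∈ sphere (0 : X) 1, ∀ x' ∈ sphere (0 : X) 1, ‖f x - f x'‖ = ‖x - x'‖)
    {x y : X} (hx : x ∈ sphere (0 : X) 1) (hy : y ∈ sphere (0 : X) 1) (hys : IsSmoothPt y) :
    f x ∈ Dset (f y) ↔ x ∈ Dset y := by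
  have h := norm_add_eq_two_iff_of_isSmoothPt hbij hiso hx hy hys
  have hfx := hbij.mapsTo hx
  have hfy := hbij.mapsTo hy
  have h1 := norm_add_le x y
  have h2 := norm_add_le (f x) (f y)
  simp only [mem_sphere_zero_iff_norm] at hx hy hfx hfy
  simp only [Dset, mem_ofPred_eq, mem_sphere_zero_iff_norm, hx, hfx, true_and]
  rw [lt_iff_le_and_ne, lt_iff_le_and_ne, Ne, Ne, h]
  exact and_congr_left fun _ => ⟨fun _ => by linarith, fun _ => by linarith⟩

/-- If `f` maps `D_y` into `D_{f y}`, then `W_y` is dense in `D_y`. -/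
lemma exists_mem_Wset_near [FiniteDimensional ℝ X] [FiniteDimensional ℝ E]
    (hbij : BijOn f (sphere (0 : X) 1) (sphere (0 : E) 1))
    (hiso : ∀ x ∈ sphere (0 : X) 1, ∀ x' ∈ sphere (0 : X) 1, ‖f x - f x'‖ = ‖x - x'‖)
    {y : X} (hy : y ∈ sphere (0 : X) 1) (hD : ∀ x ∈ Dset y, f x ∈ Dset (f y))
    {x : X} (hx : x ∈ Dset y) {ε : ℝ} (hε : 0 < ε) : ∃ x' ∈ Wset f y, ‖x' - x‖ < ε := by
  have hcont : Continuous fun p : sphere (0 : X) 1 => f p := by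
    refine (Isometry.of_dist_eq fun p q => ?_).continuous
    rw [dist_eq_norm, hiso p p.2 q q.2, Subtype.dist_eq, dist_eq_norm]
  have hy1 : ‖y‖ = 1 := by simpa using hy
  have hfy1 : ‖f y‖ = 1 := by simpa using hbij.mapsTo hy
  let s := TopologicalSpace.denseSeq X
  let s' := TopologicalSpace.denseSeq E
  let D : Set (sphere (0 : X) 1) := {p | (p : X) ∈ Dset y}
  let A : ℕ × ℕ → Set (sphere (0 : X) 1) := fun i => {p | (p : X) - y ∈ almostSmooth (s i.1) i.2}
  let B : ℕ × ℕ → Set (sphere (0 : X) 1) := fun i =>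
    {p | f p - f y ∈ almostSmooth (s' i.1) i.2}
  have hDopen : IsOpen D := by
    have : D = {p : sphere (0 : X) 1 | ‖(p : X) + y‖ < 2} := by
      ext p
      simp [D, Dset]
    rw [this]
    exact isOpen_lt (by fun_prop) (by fun_prop)
  have hA : ∀ i, IsOpen (A i) := fun i => (isOpen_almostSmooth _ _).preimage (by fun_prop)
  have hB : ∀ i, IsOpen (B i) := fun i =>
    (isOpen_almostSmooth _ _).preimage (hcont.sub continuous_const)
  have dense_of_near : ∀ C : Set (sphere (0 : X) 1),
      (∀ p ∈ D, ∀ η > 0, ∃ q ∈ C, dist q p < η) → Dense (C ∪ (closure D)ᶜ) := by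
    intro C hC p
    by_cases hp : p ∈ closure D
    · refine closure_mono subset_union_left (closure_minimal (fun q hq => ?_) isClosed_closure hp)
      refine Metric.mem_closure_iff.2 fun η hη => ?_
      obtain ⟨q', hq', hd⟩ := hC q hq η hη
      exact ⟨q', hq', by rwa [dist_comm]⟩
    · exact subset_closure (.inr hp)
  have hAd : ∀ i, Dense (A i ∪ (closure D)ᶜ) := by
    refine fun i => dense_of_near _ fun p hp η hη => ?_
    obtain ⟨q, hq1, hqp, hq⟩ := exists_sphere_near_sub_mem (mem_sphere_zero_iff_norm.1 hp.1) hy1 hp.2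
      (dense_almostSmooth (s i.1) i.2) (fun v hv c hc => smul_mem_almostSmooth hv hc) hη
    exact ⟨⟨q, by simp [hq1]⟩, hq, by rwa [Subtype.dist_eq, dist_eq_norm]⟩
  have hBd : ∀ i, Dense (B i ∪ (closure D)ᶜ) := by
    refine fun i => dense_of_near _ fun p hp η hη => ?_
    have hfp := hD _ hp
    obtain ⟨e, he1, hep, he⟩ := exists_sphere_near_sub_mem (by simpa using hfp.1) hfy1 hfp.2
      (dense_almostSmooth (s' i.1) i.2) (fun v hv c hc => smul_mem_almostSmooth hv hc) hη
    obtain ⟨q, hq, rfl⟩ := hbij.surjOn (show e ∈ sphere (0 : E) 1 by simpa using he1)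
    refine ⟨⟨q, hq⟩, he, ?_⟩
    rwa [Subtype.dist_eq, dist_eq_norm, ← hiso q hq p p.2]
  have hAr := dense_iInter_of_isOpen (fun i => (hA i).union isClosed_closure.isOpen_compl) hAd
  have hBr := dense_iInter_of_isOpen (fun i => (hB i).union isClosed_closure.isOpen_compl) hBd
  have hAB := hAr.inter_of_Gδ
    (.iInter_of_isOpen fun i => (hA i).union isClosed_closure.isOpen_compl)
    (.iInter_of_isOpen fun i => (hB i).union isClosed_closure.isOpen_compl) hBr
  obtain ⟨p, ⟨hpx, hpD⟩, hpA, hpB⟩ := hAB.inter_open_nonempty _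
    ((isOpen_ball (x := (⟨x, hx.1⟩ : sphere (0 : X) 1)) (ε := ε)).inter hDopen)
    ⟨⟨x, hx.1⟩, mem_ball_self hε, hx⟩
  have hpA' : ∀ i, p ∈ A i := fun i =>
    (mem_iInter.1 hpA i).resolve_right fun h => h (subset_closure hpD)
  have hpB' : ∀ i, p ∈ B i := fun i =>
    (mem_iInter.1 hpB i).resolve_right fun h => h (subset_closure hpD)
  have hpy : (p : X) - y ≠ 0 := by
    intro h0
    have h2 := hpD.2
    rw [sub_eq_zero.1 h0, ← two_smul ℝ, norm_smul, hy1] at h2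
    norm_num at h2
  have hfpy : f p - f y ≠ 0 := by
    rw [← norm_ne_zero_iff, hiso p p.2 y hy]
    exact norm_ne_zero_iff.2 hpy
  refine ⟨p, ⟨hpD, ?_, ?_⟩, ?_⟩
  · exact isSmoothPt_unitDir_of_almostSmooth hpy (TopologicalSpace.denseRange_denseSeq X)
      fun m n => hpA' (m, n)
  · exact isSmoothPt_unitDir_of_almostSmooth hfpy (TopologicalSpace.denseRange_denseSeq E)
      fun m n => hpB' (m, n)
  · rwa [mem_ball, Subtype.dist_eq, dist_eq_norm] at hpx

end SphereIsometry

/-- **Lemma 3, "moreover" part.** If `y` (resp. `f y`) is a smooth point, then the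
corresponding set of support functionals coming from `W_y` is 1-norming. -/
theorem lemma3_norming {X E : Type*} [NormedAddCommGroup X] [NormedSpace ℝ X]
    [FiniteDimensional ℝ X] [NormedAddCommGroup E] [NormedSpace ℝ E] [FiniteDimensional ℝ E]
    (f : X → E) (hbij : Set.BijOn f (sphere (0 : X) 1) (sphere (0 : E) 1))
    (hiso : ∀ x ∈ sphere (0 : X) 1, ∀ x' ∈ sphere (0 : X) 1, ‖f x - f x'‖ = ‖x - x'‖)
    (y : X) (hy : y ∈ sphere (0 : X) 1) :
    (IsSmoothPt y → ∀ z : X,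
      sSup {t : ℝ | ∃ x ∈ Wset f y, ∃ g : X →L[ℝ] ℝ,
        suppFn X (unitDir (x - y)) = {g} ∧ t = |g z|} = ‖z‖) ∧
    (IsSmoothPt (f y) → ∀ e : E,
      sSup {t : ℝ | ∃ x ∈ Wset f y, ∃ g : E →L[ℝ] ℝ,
        suppFn E (unitDir (f x - f y)) = {g} ∧ t = |g e|} = ‖e‖) := by
  refine ⟨fun hys z => ?_, fun hys e => ?_⟩
  · have hD : ∀ x ∈ Dset y, f x ∈ Dset (f y) := fun x hx =>
      (map_mem_Dset_iff_of_isSmoothPt hbij hiso hx.1 hy hys).2 hx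
    exact sSup_suppFn_eq_norm (by simpa using hy) hys (fun x hx => hx.2.1)
      (fun x hx ε hε => exists_mem_Wset_near hbij hiso hy hD hx hε) z
  · have hfy := hbij.mapsTo hy
    have hinv := hbij.invOn_invFunOn
    have hbij' := hinv.symm.bijOn hbij.surjOn.mapsTo_invFunOn hbij.mapsTo
    have hiso' : ∀ a ∈ sphere (0 : E) 1, ∀ b ∈ sphere (0 : E) 1,
        ‖Function.invFunOn f (sphere 0 1) a - Function.invFunOn f (sphere 0 1) b‖ = ‖a - b‖ := by
      intro a ha b hb
      rw [← hiso _ (hbij'.mapsTo ha) _ (hbij'.mapsTo hb), hinv.2 ha, hinv.2 hb]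
    have hD : ∀ x ∈ sphere (0 : X) 1, (x ∈ Dset y ↔ f x ∈ Dset (f y)) := by
      intro x hx
      have h := map_mem_Dset_iff_of_isSmoothPt hbij' hiso' (hbij.mapsTo hx) hfy hys
      rwa [hinv.1 hx, hinv.1 hy] at h
    have key := sSup_suppFn_eq_norm (W := f '' Wset f y) (by simpa using hfy) hys
      (by rintro _ ⟨x, hx, rfl⟩; exact hx.2.2) (fun a ha ε hε => ?_) e
    · simpa only [exists_mem_image] using key
    · obtain ⟨x, hx, rfl⟩ := hbij.surjOn ha.1
      obtain ⟨x', hx', hlt⟩ := exists_mem_Wset_near hbij hiso hy (fun x hx => (hD x hx.1).1 hx)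
        ((hD x hx).2 ha) hε
      exact ⟨f x', mem_image_of_mem f hx', by rwa [hiso x' hx'.1.1 x hx]⟩
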